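/- Let (G, L) be an instance of Proper-MLCM-P (no line is a subpath of another) whose lines admit consistent directions, and let the top sides of the ports be assigned according to these directions (at the port of u for edge (u,v), the lines terminating at u terminate on the top side if and only if the lines on (u,v) are directed from u to v). Then the graph G_ab of the instance contains no odd cycle consisting only of variable vertices l_u; consequently, G_ab is almost bipartite. -/

import Mathlib

/-!
Core model for metro-line crossing minimization (MLCM).

An embedded graph is a symmetric loopless graph together with, for each
vertex, a list of its neighbours in clockwise order (the embedding).
A line is a simple path in the graph.  A line layout assigns to each
ordered pair `(u, v)` forming an edge the clockwise order `ord u v` in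
which the lines through `{u, v}` meet the port of `u`.
-/

structure EmbeddedGraph (V : Type) where
  adj : V → V → Prop
  symm : ∀ {u v}, adj u v → adj v u
  loopless : ∀ v, ¬ adj v v
  rot : V → List V
  rot_mem : ∀ u v, v ∈ rot u ↔ adj u v
  rot_nodup : ∀ u, (rot u).Nodup

/-- `p` is a simple path (with at least one edge) in `G`. -/
def EmbeddedGraph.IsPath {V : Type} (G : EmbeddedGraph V) (p : List V) : Prop :=
  p.Nodup ∧ 2 ≤ p.length ∧ p.Chain' G.adj

/-- An instance of MLCM: an embedded graph together with a set of lines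
(indexed by `ι`), each a simple path. -/
structure MLCMInstance (V ι : Type) where
  G : EmbeddedGraph V
  line : ι → List V
  line_path : ∀ i, G.IsPath (line i)

namespace MLCMInstance

variable {V ι : Type}

/-- Line `i` passes through the edge `{u, v}`. -/
def usesEdge (M : MLCMInstance V ι) (i : ι) (u v : V) : Prop :=
  [u, v] <:+: M.line i ∨ [v, u] <:+: M.line i

/-- `u` is a terminal (an endpoint) of line `i`. -/
def Terminal (M : MLCMInstance V ι) (i : ι) (u : V) : Prop :=
  (M.line i).head? = some u ∨ (M.line i).getLast? = some u

/-- A line layout: for each ordered pair `(u, v)`, the clockwise order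
(at the port of `u`) of the lines through the edge `{u, v}`. -/
structure Layout (M : MLCMInstance V ι) where
  ord : V → V → List ι
  nodup : ∀ u v, (ord u v).Nodup
  mem_iff : ∀ u v i, i ∈ ord u v ↔ M.usesEdge i u v

variable {M : MLCMInstance V ι}

/-- Lines `i` and `j` have an edge crossing on the edge `{u, v}`:
they appear in the same relative order in both port orders. -/
def EdgeCross (lay : M.Layout) (i j : ι) (u v : V) : Prop :=
  i ≠ j ∧ List.Sublist [i, j] (lay.ord u v) ∧ List.Sublist [i, j] (lay.ord v u)

/-- The cyclic concatenation of the port orders at `u`, following the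
clockwise order of the edges incident to `u`. -/
def cyclicAt (lay : M.Layout) (u : V) : List ι :=
  (M.G.rot u).flatMap fun w => lay.ord u w

/-- Lines `i` and `j` have a vertex crossing at `u`: they alternate
`… i … j … i … j …` in the cyclic concatenation of the port orders. -/
def VertexCross (lay : M.Layout) (i j : ι) (u : V) : Prop :=
  i ≠ j ∧ ∃ n, List.Sublist [i, j, i, j] ((cyclicAt lay u).rotate n)

/-- Lines `i` and `j` cross in the layout. -/
def Crosses (lay : M.Layout) (i j : ι) : Prop :=
  (∃ u v, EdgeCross lay i j u v ∨ EdgeCross lay j i u v) ∨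
  (∃ u, VertexCross lay i j u ∨ VertexCross lay j i u)

/-- The pair of lines `i, j` has an unavoidable crossing: the lines
cross in every line layout. -/
def Unavoidable (M : MLCMInstance V ι) (i j : ι) : Prop :=
  ∀ lay : M.Layout, Crosses lay i j

/-- A vertex crossing of `i, j` at `u` is unavoidable: it occurs in
every line layout. -/
def UnavoidableVC (M : MLCMInstance V ι) (i j : ι) (u : V) : Prop :=
  ∀ lay : M.Layout, VertexCross lay i j u ∨ VertexCross lay j i u

/-- A layout is feasible when it contains no avoidable vertex crossings. -/
def Feasible (lay : M.Layout) : Prop :=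
  ∀ i j u, VertexCross lay i j u → M.UnavoidableVC i j u

/-- A layout is crossing-free when no two lines cross in it. -/
def CrossingFree (lay : M.Layout) : Prop :=
  ∀ i j, i ≠ j → ¬ Crosses lay i j

/-- The periphery condition: at every port the lines terminating at that
vertex occupy the outermost positions of the port order. -/
def Periphery (lay : M.Layout) : Prop :=
  ∀ u v, ∃ s₁ s₂ s₃ : List ι, lay.ord u v = s₁ ++ s₂ ++ s₃ ∧
    (∀ i ∈ s₁, M.Terminal i u) ∧ (∀ i ∈ s₂, ¬ M.Terminal i u) ∧
    (∀ i ∈ s₃, M.Terminal i u)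

/-- `P` occurs as a (contiguous) subpath of line `i` (in either direction). -/
def InfixOf (M : MLCMInstance V ι) (i : ι) (P : List V) : Prop :=
  P <:+: M.line i ∨ P.reverse <:+: M.line i

/-- `P` is a common subpath (with at least one edge) of lines `i` and `j`. -/
def CommonSubpath (M : MLCMInstance V ι) (i j : ι) (P : List V) : Prop :=
  2 ≤ P.length ∧ M.InfixOf i P ∧ M.InfixOf j P

/-- `P` is the (maximal) common subpath of lines `i` and `j`. -/
def MaxCommonSubpath (M : MLCMInstance V ι) (i j : ι) (P : List V) : Prop :=
  M.CommonSubpath i j P ∧ ∀ Q, M.CommonSubpath i j Q → Q.length ≤ P.length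

/-- No line is a subpath of another line. -/
def ProperLines (M : MLCMInstance V ι) : Prop :=
  ∀ i j, i ≠ j → ¬ M.InfixOf j (M.line i)

/-- Relative to the edge directed from `u` to `v`: line `i` is above
line `j` in every crossing-free solution. -/
def MustAbove (M : MLCMInstance V ι) (i j : ι) (u v : V) : Prop :=
  ∀ lay : M.Layout, Feasible lay → CrossingFree lay → List.Sublist [i, j] (lay.ord u v)

/-- `i, j` is an overlapping pair with common subpath `P` from `u` to `v`:
`i` has its terminal at `u`, and `j` has its terminal at `v`. -/
def OverlappingPair (M : MLCMInstance V ι) (i j : ι) (P : List V) (u v : V) : Prop :=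
  i ≠ j ∧ M.MaxCommonSubpath i j P ∧ P.head? = some u ∧ P.getLast? = some v ∧
    M.Terminal i u ∧ M.Terminal j v ∧ ¬ M.Terminal i v ∧ ¬ M.Terminal j u

/-- `l` is a separator of the overlapping pair `i, j` with common subpath `P`:
on `P`, in every crossing-free solution, `l` lies between `i` and `j`. -/
def Separator (M : MLCMInstance V ι) (i j : ι) (P : List V) (l : ι) : Prop :=
  l ≠ i ∧ l ≠ j ∧ ∃ u v, [u, v] <:+: P ∧
    ((M.MustAbove i l u v ∧ M.MustAbove l j u v) ∨
     (M.MustAbove j l u v ∧ M.MustAbove l i u v))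

end MLCMInstance

namespace MLCMInstance

variable {V ι : Type}

/-- Line `i`, directed according to `d` (`true` = as listed, `false` =
reversed), traverses the edge `{u, v}` from `u` to `v`. -/
def traversesFrom (M : MLCMInstance V ι) (i : ι) (u v : V) (d : Bool) : Prop :=
  [u, v] <:+: (if d then M.line i else (M.line i).reverse)

/-- The directions `dir` are consistent: for every edge, all lines passing
through it traverse it in the same direction. -/
def ConsistentDirections (M : MLCMInstance V ι) (dir : ι → Bool) : Prop :=
  ∀ (u v : V) (i j : ι), M.usesEdge i u v → M.usesEdge j u v →
    (M.traversesFrom i u v (dir i) ↔ M.traversesFrom j u v (dir j))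

/-- The pair of terminals `(i, u)` and `(j, v)` gives rise to a crossing
formula `(l_u ∨ l'_v) ∧ (¬ l_u ∨ ¬ l'_v)` of the 2SAT model, i.e. an edge
`(l_u, l'_v)` of the graph `G_ab`: the lines form an overlapping pair whose
common subpath runs from `u` to `v`, `i` terminating at `u` and `j` at `v`. -/
def OverlapEdgePair (M : MLCMInstance V ι) (i : ι) (u : V) (j : ι) (v : V) : Prop :=
  ∃ P : List V, M.OverlappingPair i j P u v

end MLCMInstance

/-- A graph is almost bipartite with special vertices `b` and `t`:
removing `b` and `t` leaves a bipartite graph (all remaining edges are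
incident to `b` or to `t`). -/
def AlmostBipartite {W : Type} (G : SimpleGraph W) (b t : W) : Prop :=
  b ≠ t ∧ ∃ C : Set W, ∀ ⦃u v : W⦄, G.Adj u v →
    u ≠ b → u ≠ t → v ≠ b → v ≠ t → (u ∈ C ↔ v ∉ C)

theorem List.Nodup.not_infix_pair_swap {α : Type*} {L : List α} (hL : L.Nodup) {a b : α}
    (h₁ : [a, b] <:+: L) (h₂ : [b, a] <:+: L) : False := by
  obtain ⟨s, t, rfl⟩ := h₁
  obtain ⟨s', t', h⟩ := h₂
  rw [List.nodup_iff_getElem?_ne_getElem?] at hL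
  have e₁ : (s ++ [a, b] ++ t)[s.length]? = some a := by simp
  have e₂ : (s ++ [a, b] ++ t)[s.length + 1]? = some b := by simp
  have e₃ : (s ++ [a, b] ++ t)[s'.length]? = some b := by rw [← h]; simp
  have e₄ : (s ++ [a, b] ++ t)[s'.length + 1]? = some a := by rw [← h]; simp
  have l₁ := (List.getElem?_eq_some_iff.mp e₁).1
  have l₂ := (List.getElem?_eq_some_iff.mp e₂).1
  have l₃ := (List.getElem?_eq_some_iff.mp e₃).1
  have l₄ := (List.getElem?_eq_some_iff.mp e₄).1
  rcases lt_trichotomy s.length (s'.length + 1) with hlt | heq | hgt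
  · exact hL _ _ hlt l₄ (e₁.trans e₄.symm)
  · exact hL s'.length (s.length + 1) (by omega) l₂ (e₃.trans e₂.symm)
  · exact hL _ _ hgt l₁ (e₄.trans e₁.symm)

theorem List.Nodup.getLast?_ne_head?_of_infix {α : Type*} {L P : List α} (hL : L.Nodup)
    (hP : P <:+: L) (hlen : 2 ≤ P.length) {u : α} (hu : P.head? = some u) :
    L.getLast? ≠ some u := by
  obtain ⟨s, t, rfl⟩ := hP
  match P, hlen, hu with
  | a :: b :: P', _, hu =>
    obtain rfl : a = u := by simpa using hu
    intro h
    have h' : (b :: (P' ++ t)).getLast? = some a := by simpa using h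
    have hmem : a ∈ b :: (P' ++ t) := List.mem_of_getLast? h'
    have hnd : (a :: b :: (P' ++ t)).Nodup := by
      refine hL.sublist ?_
      simp
    exact (List.nodup_cons.mp hnd).1 hmem

theorem List.Nodup.head?_ne_getLast?_of_infix {α : Type*} {L P : List α} (hL : L.Nodup)
    (hP : P <:+: L) (hlen : 2 ≤ P.length) {v : α} (hv : P.getLast? = some v) :
    L.head? ≠ some v := by
  have := (List.nodup_reverse.mpr hL).getLast?_ne_head?_of_infix (List.reverse_infix.mpr hP)
    (by simpa using hlen) (u := v) (by simpa using hv)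
  simpa using this

theorem List.exists_pair_infix_of_two_le_length {α : Type*} {P : List α} (h : 2 ≤ P.length) :
    ∃ a b, [a, b] <:+: P := by
  match P, h with
  | a :: b :: P', _ => exact ⟨a, b, [], P', by simp⟩

namespace MLCMInstance

variable {V ι : Type}

/-- The vertex list of line `i`, traversed in the direction `dir i`. -/
def directedLine (M : MLCMInstance V ι) (dir : ι → Bool) (i : ι) : List V :=
  if dir i then M.line i else (M.line i).reverse

theorem nodup_directedLine (M : MLCMInstance V ι) (dir : ι → Bool) (i : ι) :
    (M.directedLine dir i).Nodup := by
  have := (M.line_path i).1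
  unfold directedLine
  split_ifs <;> simpa using this

theorem InfixOf.directedLine {M : MLCMInstance V ι} {i : ι} {P : List V} (h : M.InfixOf i P)
    (dir : ι → Bool) :
    P <:+: M.directedLine dir i ∨ P.reverse <:+: M.directedLine dir i := by
  unfold MLCMInstance.directedLine
  split_ifs
  · exact h
  · rw [List.reverse_infix, ← List.reverse_infix, List.reverse_reverse]
    exact h.symm

theorem Terminal.directedLine {M : MLCMInstance V ι} {i : ι} {u : V} (h : M.Terminal i u)
    (dir : ι → Bool) :
    (M.directedLine dir i).head? = some u ∨ (M.directedLine dir i).getLast? = some u := by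
  unfold MLCMInstance.directedLine
  split_ifs
  · exact h
  · simpa using h.symm

theorem usesEdge_of_infix_directedLine {M : MLCMInstance V ι} {dir : ι → Bool} {i : ι} {u v : V}
    (h : [u, v] <:+: M.directedLine dir i) : M.usesEdge i u v := by
  unfold directedLine at h
  split_ifs at h
  · exact .inl h
  · exact .inr (by simpa using List.reverse_infix.mpr h)

theorem usesEdge.symm {M : MLCMInstance V ι} {i : ι} {u v : V} (h : M.usesEdge i u v) :
    M.usesEdge i v u :=
  Or.symm h

/-- Consistently directed lines traverse every common subpath in the same direction. -/
theorem ConsistentDirections.not_infix_reverse {M : MLCMInstance V ι} {dir : ι → Bool}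
    (hcons : M.ConsistentDirections dir) {i j : ι} {P : List V} (hlen : 2 ≤ P.length)
    (hi : P <:+: M.directedLine dir i) (hj : P.reverse <:+: M.directedLine dir j) : False := by
  obtain ⟨a, b, hab⟩ := List.exists_pair_infix_of_two_le_length hlen
  have hi' := hab.trans hi
  have hj' : [b, a] <:+: M.directedLine dir j :=
    (by simpa using List.reverse_infix.mpr hab : [b, a] <:+: P.reverse).trans hj
  exact (M.nodup_directedLine dir j).not_infix_pair_swap
    ((hcons a b i j (usesEdge_of_infix_directedLine hi')
      (usesEdge_of_infix_directedLine hj').symm).mp hi') hj'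

theorem ConsistentDirections.head?_iff_of_overlapEdgePair {M : MLCMInstance V ι} {dir : ι → Bool}
    (hcons : M.ConsistentDirections dir) {i j : ι} {u v : V} (h : M.OverlapEdgePair i u j v) :
    (M.directedLine dir i).head? = some u ↔ (M.directedLine dir j).head? ≠ some v := by
  obtain ⟨P, -, ⟨⟨hlen, hi, hj⟩, -⟩, hu, hv, hti, htj, -, -⟩ := h
  have ndi := M.nodup_directedLine dir i
  have ndj := M.nodup_directedLine dir j
  have hlen' : 2 ≤ P.reverse.length := by simpa using hlen
  rcases hi.directedLine dir with hi | hi <;> rcases hj.directedLine dir with hj | hj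
  · exact iff_of_true
      ((hti.directedLine dir).resolve_right (ndi.getLast?_ne_head?_of_infix hi hlen hu))
      (ndj.head?_ne_getLast?_of_infix hj hlen hv)
  · exact (hcons.not_infix_reverse hlen hi hj).elim
  · exact (hcons.not_infix_reverse hlen hj hi).elim
  · exact iff_of_false
      (ndi.head?_ne_getLast?_of_infix hi hlen' (by simpa using hu))
      (not_not.mpr ((htj.directedLine dir).resolve_right
        (ndj.getLast?_ne_head?_of_infix hj hlen' (by simpa using hv))))

end MLCMInstance

/-- Along a walk whose edges within `S` all switch sides of `C`, the length is odd exactly when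
the endpoints lie on different sides. -/
theorem SimpleGraph.Walk.odd_length_iff_of_switching {W : Type*} {G : SimpleGraph W} {S C : Set W}
    (hC : ∀ ⦃x y⦄, G.Adj x y → x ∈ S → y ∈ S → (x ∈ C ↔ y ∉ C)) {x y : W} (w : G.Walk x y)
    (hS : ∀ z ∈ w.support, z ∈ S) : Odd w.length ↔ (x ∈ C ↔ y ∉ C) := by
  induction w with
  | nil => simp
  | cons hadj p ih =>
    have hp : ∀ z ∈ p.support, z ∈ S := fun z hz => hS z (by simp [hz])
    have h := hC hadj (hS _ (by simp)) (hp _ p.start_mem_support)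
    rw [SimpleGraph.Walk.length_cons, Nat.odd_add_one, ih hp]
    tauto

open MLCMInstance in
/-- Let `(G, L)` be an instance of Proper-MLCM-P (no line
is a subpath of another) whose lines admit consistent directions, with the top
sides of the ports assigned according to these directions.  Then the graph
`G_ab` of the 2SAT model — whose vertices are the variables `l_u` (pairs of a
line and a terminal) together with two special vertices `b = Sum.inr false`
and `t = Sum.inr true`, and whose edges between variable vertices are exactly
the overlapping pairs — contains no odd cycle consisting only of variable
vertices; consequently, `G_ab` is almost bipartite. -/
theorem properMLCMP_Gab_no_odd_variable_cycle_and_almost_bipartite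
    {V ι : Type} [Fintype ι] (M : MLCMInstance V ι)
    (hproper : M.ProperLines)
    (dir : ι → Bool) (hcons : M.ConsistentDirections dir)
    (Gab : SimpleGraph ((ι × V) ⊕ Bool))
    (hvar : ∀ (i : ι) (u : V) (j : ι) (v : V),
      Gab.Adj (Sum.inl (i, u)) (Sum.inl (j, v)) ↔
        (M.OverlapEdgePair i u j v ∨ M.OverlapEdgePair j v i u)) :
    (∀ (x : (ι × V) ⊕ Bool) (w : Gab.Walk x x), w.IsCycle →
      (∀ y ∈ w.support, ∃ p : ι × V, y = Sum.inl p) → ¬ Odd w.length) ∧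
    AlmostBipartite Gab (Sum.inr false) (Sum.inr true) := by
  have hC : ∀ ⦃x y⦄, Gab.Adj x y → x ∈ Set.range Sum.inl → y ∈ Set.range Sum.inl →
      (x ∈ Sum.inl '' {p : ι × V | (M.directedLine dir p.1).head? = some p.2} ↔
        y ∉ Sum.inl '' {p : ι × V | (M.directedLine dir p.1).head? = some p.2}) := by
    rintro _ _ hadj ⟨⟨i, u⟩, rfl⟩ ⟨⟨j, v⟩, rfl⟩
    simp only [Sum.inl_injective.mem_set_image, Set.mem_ofPred_eq]
    rcases (hvar i u j v).mp hadj with h | h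
    · exact hcons.head?_iff_of_overlapEdgePair h
    · have := hcons.head?_iff_of_overlapEdgePair h
      tauto
  refine ⟨fun x w _ hw hodd => ?_, by simp, _, fun x y hadj hxb hxt hyb hyt => hC hadj ?_ ?_⟩
  · have := (w.odd_length_iff_of_switching hC fun z hz => ?_).mp hodd
    · tauto
    · obtain ⟨p, rfl⟩ := hw z hz
      exact ⟨p, rfl⟩
  · rcases x with p | _ | _ <;> simp_all
  · rcases y with p | _ | _ <;> simp_all
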